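/- Let π_P : ℝ^n → ℝ^n/K(P) be the natural projection. Then the image Q := π_P(P) is a rational polytope with respect to the lattice L := ℤ^n/(K(P) ∩ ℤ^n), and its Q-codegree (computed with respect to L) satisfies μ(Q) ≥ μ(P). Moreover, if μ(Q) = μ(P), then core(Q) is the single point π_P(core(P)). -/

import Mathlib

open scoped BigOperators Pointwise

noncomputable section

/-- Pairing `⟨a, x⟩ = ∑ aⱼ xⱼ` of an integer linear functional with a real point. -/
def ipair {n : ℕ} (a : Fin n → ℤ) (x : Fin n → ℝ) : ℝ := ∑ j, (a j : ℝ) * x j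

/-- An integer vector is primitive if it is nonzero and not a nontrivial integer
multiple of another integer vector. -/
def IsPrimitive {n : ℕ} (a : Fin n → ℤ) : Prop :=
  a ≠ 0 ∧ ∀ (k : ℤ) (b : Fin n → ℤ), a = k • b → IsUnit k

/-- The set of integer (lattice) points of `ℝⁿ`. -/
def IntPts (n : ℕ) : Set (Fin n → ℝ) := Set.range (fun z : Fin n → ℤ => fun j => (z j : ℝ))

/-- The dimension of a subset of `ℝⁿ` (the dimension of its affine hull). -/
def setDim {n : ℕ} (S : Set (Fin n → ℝ)) : ℕ := Module.finrank ℝ (vectorSpan ℝ S)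

/-- An irredundant facet description `P = {x : A x ≥ b}` of an `n`-dimensional
rational polytope: the rows `aᵢ` of `A` are primitive integer vectors, the right hand
sides are rational, `P` is bounded and `n`-dimensional, every inequality defines a facet
(a face of dimension `n-1`), and no inequality is repeated. -/
structure PolyDesc (n m : ℕ) : Type where
  hm : 0 < m
  A : Fin m → Fin n → ℤ
  b : Fin m → ℚ
  prim : ∀ i, IsPrimitive (A i)
  bounded : Bornology.IsBounded {x : Fin n → ℝ | ∀ i, (b i : ℝ) ≤ ipair (A i) x}
  fulldim : setDim {x : Fin n → ℝ | ∀ i, (b i : ℝ) ≤ ipair (A i) x} = n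
  facet_dim : ∀ i, setDim {x : Fin n → ℝ |
      (∀ j, (b j : ℝ) ≤ ipair (A j) x) ∧ ipair (A i) x = (b i : ℝ)} + 1 = n
  irredundant : Function.Injective (fun i => (A i, b i))

namespace PolyDesc

variable {n m : ℕ} (D : PolyDesc n m)

/-- The polytope `P` itself. -/
def pts : Set (Fin n → ℝ) := {x | ∀ i, (D.b i : ℝ) ≤ ipair (D.A i) x}

/-- Lattice distance `d_{Fᵢ}(x) = ⟨aᵢ, x⟩ - bᵢ` from (the hyperplane spanned by)
the `i`-th facet. -/
def dF (i : Fin m) (x : Fin n → ℝ) : ℝ := ipair (D.A i) x - (D.b i : ℝ)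

/-- Lattice distance `d_P(x) = minᵢ d_{Fᵢ}(x)` from the boundary of `P`. -/
def dist (x : Fin n → ℝ) : ℝ :=
  Finset.univ.inf'
    (Finset.univ_nonempty_iff.mpr (Fin.pos_iff_nonempty.mp D.hm))
    (fun i => D.dF i x)

/-- The adjoint polytope `P⁽ˢ⁾ = {x : d_P(x) ≥ s}`. -/
def adj (s : ℝ) : Set (Fin n → ℝ) := {x | s ≤ D.dist x}

/-- The `i`-th facet `Fᵢ` of `P`. -/
def facet (i : Fin m) : Set (Fin n → ℝ) := {x ∈ D.pts | ipair (D.A i) x = (D.b i : ℝ)}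

/-- The set `{s > 0 : P⁽ˢ⁾ ≠ ∅}`, whose supremum is `μ(P)⁻¹`. -/
def qcdInvSet : Set ℝ := {s : ℝ | 0 < s ∧ (D.adj s).Nonempty}

/-- `μ(P)⁻¹ = sup {s > 0 : P⁽ˢ⁾ ≠ ∅}`. -/
def qcdInv : ℝ := sSup D.qcdInvSet

/-- The ℚ-codegree `μ(P) = (sup {s > 0 : P⁽ˢ⁾ ≠ ∅})⁻¹`. -/
def qcd : ℝ := D.qcdInv⁻¹

/-- The core `core(P) = P^{(1/μ(P))}`. -/
def core : Set (Fin n → ℝ) := D.adj D.qcdInv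

/-- The codegree `cd(P) = min {k ∈ ℕ, k ≥ 1 : int(kP) ∩ ℤⁿ ≠ ∅}`. -/
def codeg : ℕ := sInf {k : ℕ | 0 < k ∧
  ∃ z : Fin n → ℤ, (fun j => (z j : ℝ)) ∈ interior ((k : ℝ) • D.pts)}

end PolyDesc

/-- The face of `S` on which the linear functional `u` is maximized. -/
def argFace {n : ℕ} (S : Set (Fin n → ℝ)) (u : Fin n → ℝ) : Set (Fin n → ℝ) :=
  {x ∈ S | ∀ y ∈ S, ∑ j, u j * y j ≤ ∑ j, u j * x j}

/-- `S` and `T` have the same normal fan: two linear functionals lie in the same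
(relatively open) cone of the normal fan of `S`, i.e. are maximized on the same face
of `S`, iff the same holds for `T`. -/
def SameNormalFan {n : ℕ} (S T : Set (Fin n → ℝ)) : Prop :=
  ∀ u v : Fin n → ℝ, (argFace S u = argFace S v ↔ argFace T u = argFace T v)

/-- The normal fan of `S` refines the normal fan of `T`. -/
def RefinesNormalFan {n : ℕ} (S T : Set (Fin n → ℝ)) : Prop :=
  ∀ u v : Fin n → ℝ, argFace S u = argFace S v → argFace T u = argFace T v

namespace PolyDesc
variable {n m : ℕ} (D : PolyDesc n m)

/-- `{s > 0 : N(P⁽ˢ⁾) = N(P)}`, whose supremum is `τ(P)⁻¹`. -/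
def nefInvSet : Set ℝ := {s : ℝ | 0 < s ∧ SameNormalFan (D.adj s) D.pts}

/-- `τ(P)⁻¹ = sup {s > 0 : N(P⁽ˢ⁾) = N(P)}`. -/
def nefInv : ℝ := sSup D.nefInvSet

/-- The nef value `τ(P)`. -/
def nefVal : ℝ := D.nefInv⁻¹

/-- The set of inequalities active at `x`; the normal cone of the minimal face of `P`
containing `x` is generated by `{aᵢ : i ∈ active x}`, and all cones of the normal fan
of `P` arise in this way. -/
def active (x : Fin n → ℝ) : Set (Fin m) := {i | ipair (D.A i) x = (D.b i : ℝ)}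

/-- The normal cone at the vertex `v` is ℚ-Gorenstein of index `r`, witnessed by the
primitive lattice point `u = u_σ` with `⟨aᵢ, u⟩ = r` for all active `i`. -/
def VertexQG (v : Fin n → ℝ) (u : Fin n → ℤ) (r : ℤ) : Prop :=
  IsPrimitive u ∧ 0 < r ∧ ∀ i ∈ D.active v, (∑ j, D.A i j * u j) = r

/-- The normal fan of `P` is ℚ-Gorenstein: every maximal cone (normal cone of a
vertex, i.e. of an extreme point) is ℚ-Gorenstein. -/
def QGorenstein : Prop := ∀ v ∈ Set.extremePoints ℝ D.pts, ∃ u r, D.VertexQG v u r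

end PolyDesc

/-- The point `v(s) = v + (s/r_σ) • u_σ`. -/
def vmove {n : ℕ} (v : Fin n → ℝ) (s : ℝ) (u : Fin n → ℤ) (r : ℤ) : Fin n → ℝ :=
  v + (s / (r : ℝ)) • (fun j => ((u j : ℝ)))

/-- The height of a point `y` in the cone generated by `{aᵢ : i ∈ I}`:
`ht(y) = max {∑ λᵢ : λᵢ ≥ 0, ∑ λᵢ aᵢ = y}`. -/
def coneHeight {n m : ℕ} (D : PolyDesc n m) (I : Set (Fin m)) (y : Fin n → ℝ) : ℝ :=
  sSup {t : ℝ | ∃ c : Fin m → ℝ, (∀ i, 0 ≤ c i) ∧ (∀ i ∉ I, c i = 0) ∧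
    (y = ∑ i, c i • (fun j => ((D.A i j : ℝ)))) ∧ t = ∑ i, c i}

/-- `P` is α-canonical: for every cone `σ` of the normal fan of `P` (the normal cone
of the minimal face containing a point `x ∈ P`, generated by `{aᵢ : i ∈ active x}`),
every nonzero lattice point of `σ` has height at least `α`. -/
def AlphaCanonical {n m : ℕ} (D : PolyDesc n m) (α : ℝ) : Prop :=
  ∀ x ∈ D.pts, ∀ z : Fin n → ℤ, z ≠ 0 →
    (∃ c : Fin m → ℝ, (∀ i, 0 ≤ c i) ∧ (∀ i ∉ D.active x, c i = 0) ∧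
      ((fun j => ((z j : ℝ))) = ∑ i, c i • (fun j => ((D.A i j : ℝ))))) →
    α ≤ coneHeight D (D.active x) (fun j => ((z j : ℝ)))

/-- `P` is a lattice polytope: the convex hull of finitely many integer points. -/
def IsLatticePoly {n : ℕ} (P : Set (Fin n → ℝ)) : Prop :=
  ∃ V : Finset (Fin n → ℤ),
    P = convexHull ℝ ((fun z : Fin n → ℤ => fun j => ((z j : ℝ))) '' (V : Set (Fin n → ℤ)))

/-- The `i`-th standard basis vector of `ℝᵗ`. -/
def stdBasisVec (t : ℕ) (i : Fin t) : Fin t → ℝ := fun j => if j = i then 1 else 0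

/-- The marking vectors of a Cayley sum: `0, e₁, …, e_t ∈ ℝᵗ`. -/
def cayleyVec (t : ℕ) : Fin (t + 1) → (Fin t → ℝ) :=
  fun j => if h : (j : ℕ) = 0 then 0 else stdBasisVec t ⟨(j : ℕ) - 1, by have := j.isLt; omega⟩

/-- The Cayley sum `Q₀ * ⋯ * Q_t = conv((Q₀ × {0}) ∪ (Q₁ × {e₁}) ∪ ⋯ ∪ (Q_t × {e_t}))`. -/
def cayleySum {k t : ℕ} (Q : Fin (t + 1) → Set (Fin k → ℝ)) :
    Set ((Fin k → ℝ) × (Fin t → ℝ)) :=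
  convexHull ℝ (⋃ j, (Q j) ×ˢ ({cayleyVec t j} : Set (Fin t → ℝ)))

/-- `P ⊆ ℝⁿ` is a Cayley polytope `P₀ * ⋯ * P_t` of length `t+1` of lattice polytopes
`Pⱼ ⊆ ℝᵏ` with `k + t = n`: some affine lattice isomorphism `ℤⁿ ≅ ℤᵏ × ℤᵗ`
identifies `P` with such a Cayley sum. -/
def IsCayley {n : ℕ} (P : Set (Fin n → ℝ)) (k t : ℕ) : Prop :=
  k + t = n ∧
  ∃ Q : Fin (t + 1) → Finset (Fin k → ℤ), (∀ j, (Q j).Nonempty) ∧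
  ∃ f : (Fin n → ℝ) ≃ᵃ[ℝ] (Fin k → ℝ) × (Fin t → ℝ),
    f '' IntPts n = (IntPts k) ×ˢ (IntPts t) ∧
    f '' P = cayleySum (fun j =>
      convexHull ℝ ((fun z : Fin k → ℤ => fun i => ((z i : ℝ))) '' (Q j : Set (Fin k → ℤ))))

/-- The unimodular simplex `Δₙ = conv(0, e₁, …, eₙ)`. -/
def unimodSimplex (n : ℕ) : Set (Fin n → ℝ) :=
  convexHull ℝ (insert (0 : Fin n → ℝ) (Set.range (stdBasisVec n)))

/-- Two subsets of `ℝⁿ` are unimodularly equivalent: an affine lattice automorphism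
maps one onto the other. -/
def UnimodEquiv {n : ℕ} (P P' : Set (Fin n → ℝ)) : Prop :=
  ∃ f : (Fin n → ℝ) ≃ᵃ[ℝ] (Fin n → ℝ), f '' IntPts n = IntPts n ∧ f '' P = P'

/-- The codegree `cd(P) = min {k ∈ ℕ, k ≥ 1 : int(kP) ∩ ℤⁿ ≠ ∅}` of a polytope given
as a set. -/
def codegS {n : ℕ} (P : Set (Fin n → ℝ)) : ℕ :=
  sInf {k : ℕ | 0 < k ∧ ∃ z : Fin n → ℤ, (fun j => (z j : ℝ)) ∈ interior ((k : ℝ) • P)}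

/-- `P` has lattice width one: some nonzero integer linear functional has minimum `c`
and maximum `c + 1` on `P`. -/
def HasLatticeWidthOne {n : ℕ} (P : Set (Fin n → ℝ)) : Prop :=
  ∃ u : Fin n → ℤ, u ≠ 0 ∧ ∃ c : ℤ,
    (∀ x ∈ P, (c : ℝ) ≤ ipair u x ∧ ipair u x ≤ (c : ℝ) + 1) ∧
    (∃ x ∈ P, ipair u x = (c : ℝ)) ∧ (∃ x ∈ P, ipair u x = (c : ℝ) + 1)

/-- `P` is a lattice pyramid: for some primitive `u`, `P` is the convex hull of a base
lying in the lattice hyperplane `{⟨u, ·⟩ = c}` and an apex at lattice distance one from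
it (this is equivalent to being unimodularly equivalent to
`conv((Q × {0}) ∪ {(0, …, 0, 1)})` for an `(n-1)`-dimensional lattice polytope `Q`). -/
def IsLatticePyramid {n : ℕ} (P : Set (Fin n → ℝ)) : Prop :=
  ∃ u : Fin n → ℤ, IsPrimitive u ∧ ∃ c : ℤ, ∃ apex ∈ P,
    ipair u apex = (c : ℝ) + 1 ∧
    P = convexHull ℝ ({x ∈ P | ipair u x = (c : ℝ)} ∪ {apex})

/-- `F` is a facet of `S`: an exposed face of dimension `dim S - 1`. -/
def IsFacetOf {n : ℕ} (F S : Set (Fin n → ℝ)) : Prop :=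
  IsExposed ℝ S F ∧ F.Nonempty ∧ setDim F + 1 = setDim S

/-- The pairing with an integer vector, as a linear functional. -/
def ipairLin {n : ℕ} (a : Fin n → ℤ) : (Fin n → ℝ) →ₗ[ℝ] ℝ where
  toFun := ipair a
  map_add' x y := by simp [ipair, mul_add, Finset.sum_add_distrib]
  map_smul' c x := by simp [ipair, Finset.mul_sum, mul_left_comm]

@[simp] lemma ipairLin_apply {n : ℕ} (a : Fin n → ℤ) (x : Fin n → ℝ) :
    ipairLin a x = ipair a x := rfl

lemma ipair_add {n : ℕ} (a : Fin n → ℤ) (x y : Fin n → ℝ) :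
    ipair a (x + y) = ipair a x + ipair a y := (ipairLin a).map_add x y

lemma ipair_sub {n : ℕ} (a : Fin n → ℤ) (x y : Fin n → ℝ) :
    ipair a (x - y) = ipair a x - ipair a y := (ipairLin a).map_sub x y

lemma ipair_smul {n : ℕ} (a : Fin n → ℤ) (c : ℝ) (x : Fin n → ℝ) :
    ipair a (c • x) = c * ipair a x := (ipairLin a).map_smul c x

lemma ipair_single {n : ℕ} (a : Fin n → ℤ) (j : Fin n) :
    ipair a (Pi.single j 1) = a j := by
  simp [ipair, Pi.single_apply]

lemma ipair_smul_left {n : ℕ} (k : ℤ) (a : Fin n → ℤ) (x : Fin n → ℝ) :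
    ipair (k • a) x = k * ipair a x := by
  simp [ipair, Finset.mul_sum, mul_assoc]

lemma ipair_sub_left {n : ℕ} (a b : Fin n → ℤ) (x : Fin n → ℝ) :
    ipair (a - b) x = ipair a x - ipair b x := by
  simp [ipair, sub_mul, Finset.sum_sub_distrib]

lemma continuous_ipair {n : ℕ} (a : Fin n → ℤ) : Continuous (ipair a) := by
  unfold ipair; fun_prop

lemma exists_ipair_eq_one {n : ℕ} {a : Fin n → ℤ} (ha : a ≠ 0) :
    ∃ w : Fin n → ℝ, ipair a w = 1 := by
  obtain ⟨j, hj⟩ := Function.ne_iff.mp ha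
  have hj' : (a j : ℝ) ≠ 0 := by exact_mod_cast hj
  exact ⟨(a j : ℝ)⁻¹ • Pi.single j 1, by rw [ipair_smul, ipair_single, inv_mul_cancel₀ hj']⟩

lemma ipairLin_ne_zero {n : ℕ} {a : Fin n → ℤ} (ha : a ≠ 0) : ipairLin a ≠ 0 := by
  intro h
  obtain ⟨w, hw⟩ := exists_ipair_eq_one ha
  have := LinearMap.congr_fun h w
  simp [hw] at this

lemma ipairLin_surjective {n : ℕ} {a : Fin n → ℤ} (ha : a ≠ 0) :
    Function.Surjective (ipairLin a) :=
  LinearMap.surjective (ipairLin_ne_zero ha)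

lemma finrank_ker_ipairLin {n : ℕ} {a : Fin n → ℤ} (ha : a ≠ 0) :
    Module.finrank ℝ (LinearMap.ker (ipairLin a)) + 1 = n := by
  simpa using Module.Dual.finrank_ker_add_one_of_ne_zero (f := ipairLin a) (ipairLin_ne_zero ha)

lemma isPrimitive_iff_gcd_eq_one {n : ℕ} (a : Fin n → ℤ) (hn : 0 < n) :
    IsPrimitive a ↔ Finset.univ.gcd a = 1 := by
  constructor
  · rintro ⟨-, h⟩
    obtain ⟨g, hg, -⟩ := Finset.extract_gcd a ⟨⟨0, hn⟩, Finset.mem_univ _⟩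
    have hu := h (Finset.univ.gcd a) g (by ext j; simpa using hg j (Finset.mem_univ j))
    rw [← Finset.normalize_gcd]
    exact normalize_eq_one.mpr hu
  · intro h
    refine ⟨?_, fun k b hb => ?_⟩
    · rintro rfl
      have : Finset.univ.gcd (0 : Fin n → ℤ) = 0 := by simp [Finset.gcd_eq_zero_iff]
      omega
    · have : k ∣ Finset.univ.gcd a := Finset.dvd_gcd fun j _ => ⟨b j, by simp [hb]⟩
      rw [h] at this
      exact isUnit_of_dvd_one this

lemma IsPrimitive.pos {n : ℕ} {a : Fin n → ℤ} (ha : IsPrimitive a) : 0 < n := by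
  rcases Nat.eq_zero_or_pos n with rfl | h
  · exact absurd (Subsingleton.elim a 0) ha.1
  · exact h

lemma exists_isPrimitive_smul {n : ℕ} {a : Fin n → ℤ} (ha : a ≠ 0) :
    ∃ (g : ℤ) (b : Fin n → ℤ), 0 < g ∧ IsPrimitive b ∧ a = g • b := by
  obtain ⟨j, hj⟩ := Function.ne_iff.mp ha
  have hn : 0 < n := j.pos
  obtain ⟨b, hb, hb1⟩ := Finset.extract_gcd a ⟨j, Finset.mem_univ j⟩
  refine ⟨Finset.univ.gcd a, b, ?_, (isPrimitive_iff_gcd_eq_one b hn).mpr hb1,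
    by ext i; simpa using hb i (Finset.mem_univ i)⟩
  have h0 : Finset.univ.gcd a ≠ 0 := by
    intro h
    exact hj (Finset.gcd_eq_zero_iff.mp h j (Finset.mem_univ j))
  have h1 : 0 ≤ Finset.univ.gcd a := Int.nonneg_of_normalize_eq_self Finset.normalize_gcd
  omega

lemma IsPrimitive.eq_of_ipair_eq_mul {n : ℕ} {a b : Fin n → ℤ} (ha : IsPrimitive a)
    (hb : IsPrimitive b) {t : ℝ} (ht : 0 < t) (h : ∀ x, ipair a x = t * ipair b x) :
    a = b := by
  have hn := ha.pos
  have hab : ∀ j, (a j : ℝ) = t * b j := fun j => by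
    simpa [ipair_single] using h (Pi.single j 1)
  obtain ⟨j, hj⟩ := Function.ne_iff.mp hb.1
  have hcross : ∀ i, b j * a i = a j * b i := fun i => by
    have : (b j : ℝ) * a i = a j * b i := by rw [hab, hab j]; ring
    exact_mod_cast this
  have hg : Finset.univ.gcd (fun i => b j * a i) = Finset.univ.gcd (fun i => a j * b i) := by
    simp_rw [hcross]
  rw [Finset.gcd_mul_left, Finset.gcd_mul_left, (isPrimitive_iff_gcd_eq_one a hn).mp ha,
    (isPrimitive_iff_gcd_eq_one b hn).mp hb, mul_one, mul_one,
    ← Int.abs_eq_normalize, ← Int.abs_eq_normalize] at hg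
  have habs : |(b j : ℝ)| = |(a j : ℝ)| := by
    exact_mod_cast hg
  have hbj : (b j : ℝ) ≠ 0 := by exact_mod_cast hj
  rw [hab j, abs_mul, abs_of_pos ht] at habs
  have ht1 : t = 1 := by
    have := abs_pos.mpr hbj
    nlinarith
  ext i
  have := hab i
  rw [ht1, one_mul] at this
  exact_mod_cast this

/-- Finitely many conditions `0 < α` (or `0 ≤ α` when moving in a nonnegative direction `β`)
survive a small move. -/
lemma exists_pos_forall_nonneg_add_mul {ι : Type*} (s : Finset ι) (α β : ι → ℝ)
    (h : ∀ i ∈ s, 0 < α i ∨ (0 ≤ α i ∧ 0 ≤ β i)) :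
    ∃ ε > 0, ∀ i ∈ s, 0 ≤ α i + ε * β i := by
  have key : ∀ i ∈ s, ∀ᶠ ε in nhdsWithin (0 : ℝ) (Set.Ioi 0), 0 ≤ α i + ε * β i := by
    intro i hi
    rcases h i hi with h | ⟨h1, h2⟩
    · have hc : Continuous fun ε : ℝ => α i + ε * β i := by fun_prop
      have h0 : ∀ᶠ ε in nhds (0 : ℝ), 0 < α i + ε * β i :=
        continuousAt_const.eventually_lt hc.continuousAt (by simpa using h)
      exact (h0.filter_mono nhdsWithin_le_nhds).mono fun _ => le_of_lt
    · filter_upwards [self_mem_nhdsWithin] with ε hε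
      have : (0 : ℝ) < ε := hε
      positivity
  have hall := (Filter.eventually_all_finset s).mpr key
  obtain ⟨ε, h1, h2⟩ := (hall.and self_mem_nhdsWithin).exists
  exact ⟨ε, h2, h1⟩

/-- A nonempty convex set contains a point at which every inequality of a finite valid family
which is strict somewhere on the set is strict. -/
lemma Convex.exists_forall_strict {E ι : Type*} [AddCommGroup E] [Module ℝ E] {S : Set E}
    (hS : Convex ℝ S) (hne : S.Nonempty) (s : Finset ι) (f : ι → E →ₗ[ℝ] ℝ) (b : ι → ℝ)
    (hf : ∀ i ∈ s, ∀ x ∈ S, b i ≤ f i x) :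
    ∃ z ∈ S, ∀ i ∈ s, (∃ y ∈ S, b i < f i y) → b i < f i z := by
  classical
  induction s using Finset.induction_on with
  | empty => obtain ⟨z, hz⟩ := hne; exact ⟨z, hz, by simp⟩
  | insert i s _ ih =>
    obtain ⟨z, hz, h⟩ := ih fun j hj => hf j (Finset.mem_insert_of_mem hj)
    by_cases hi : ∃ y ∈ S, b i < f i y
    · obtain ⟨y, hy, hiy⟩ := hi
      refine ⟨(1 / 2 : ℝ) • z + (1 / 2 : ℝ) • y,
        hS hz hy (by norm_num) (by norm_num) (by norm_num), fun j hj hex => ?_⟩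
      have h1 := hf j hj z hz
      have h2 := hf j hj y hy
      simp only [map_add, map_smul, smul_eq_mul]
      rcases Finset.mem_insert.mp hj with rfl | hjs
      · linarith
      · linarith [h j hjs hex]
    · refine ⟨z, hz, fun j hj hex => ?_⟩
      rcases Finset.mem_insert.mp hj with rfl | hjs
      · exact absurd hex hi
      · exact h j hjs hex

lemma lt_ipair_of_mem_interior {n : ℕ} {S : Set (Fin n → ℝ)} {a : Fin n → ℤ} (ha : a ≠ 0)
    {β : ℝ} (h : ∀ y ∈ S, β ≤ ipair a y) {x : Fin n → ℝ} (hx : x ∈ interior S) :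
    β < ipair a x := by
  have hopen : IsOpen (ipairLin a '' interior S) :=
    (ipairLin a).isOpenMap_of_finiteDimensional (ipairLin_surjective ha) _ isOpen_interior
  have hsub : ipairLin a '' interior S ⊆ Set.Ici β := by
    rintro _ ⟨y, hy, rfl⟩
    exact h y (interior_subset hy)
  have := interior_maximal hsub hopen ⟨x, hx, rfl⟩
  simpa [interior_Ici] using this

lemma Convex.interior_nonempty_of_setDim_eq {n : ℕ} {S : Set (Fin n → ℝ)} (hS : Convex ℝ S)
    (hne : S.Nonempty) (hdim : setDim S = n) : (interior S).Nonempty := by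
  rw [hS.interior_nonempty_iff_affineSpan_eq_top,
    AffineSubspace.affineSpan_eq_top_iff_vectorSpan_eq_top_of_nonempty _ _ _ hne]
  exact Submodule.eq_top_of_finrank_eq (by simpa [setDim] using hdim)

lemma vectorSpan_le_ker_of_const {n : ℕ} {S : Set (Fin n → ℝ)} {a : Fin n → ℤ} {β : ℝ}
    (h : ∀ x ∈ S, ipair a x = β) : vectorSpan ℝ S ≤ LinearMap.ker (ipairLin a) := by
  rw [vectorSpan_def, Submodule.span_le]
  rintro _ ⟨x, hx, y, hy, rfl⟩
  simp [ipair_sub, h x hx, h y hy]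

lemma nonempty_of_setDim_pos {n : ℕ} {S : Set (Fin n → ℝ)} (h : 0 < setDim S) : S.Nonempty := by
  rw [Set.nonempty_iff_ne_empty]
  rintro rfl
  rw [setDim, vectorSpan_empty, finrank_bot] at h
  exact h.false

lemma convex_setOf_le_ipair {n : ℕ} {ι : Type*} (s : Set ι) (a : ι → Fin n → ℤ) (b : ι → ℝ) :
    Convex ℝ {x : Fin n → ℝ | ∀ i ∈ s, b i ≤ ipair (a i) x} := by
  intro x hx y hy s t hs ht hst i hi
  have h1 := mul_le_mul_of_nonneg_left (hx i hi) hs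
  have h2 := mul_le_mul_of_nonneg_left (hy i hi) ht
  have h3 : b i = s * b i + t * b i := by rw [← add_mul, hst, one_mul]
  rw [ipair_add, ipair_smul, ipair_smul]
  linarith

namespace PolyDesc

variable {n m : ℕ} (D : PolyDesc n m)

lemma dim_pos {n m : ℕ} (D : PolyDesc n m) : 0 < n := (D.prim ⟨0, D.hm⟩).pos

lemma convex_pts : Convex ℝ D.pts := by
  simpa [pts] using convex_setOf_le_ipair Set.univ D.A fun i => (D.b i : ℝ)

lemma pts_nonempty : D.pts.Nonempty :=
  nonempty_of_setDim_pos (D.fulldim.symm ▸ D.dim_pos)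

lemma interior_pts_nonempty : (interior D.pts).Nonempty :=
  D.convex_pts.interior_nonempty_of_setDim_eq D.pts_nonempty D.fulldim

lemma isCompact_pts : IsCompact D.pts := by
  refine Metric.isCompact_of_isClosed_isBounded ?_ D.bounded
  have : D.pts = ⋂ i, {x | (D.b i : ℝ) ≤ ipair (D.A i) x} := by ext; simp [pts]
  rw [this]
  exact isClosed_iInter fun i => isClosed_le continuous_const (continuous_ipair _)

lemma le_dist_iff {s : ℝ} {x : Fin n → ℝ} : s ≤ D.dist x ↔ ∀ i, s ≤ D.dF i x := by
  simp [dist, Finset.le_inf'_iff]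

lemma mem_adj {s : ℝ} {x : Fin n → ℝ} : x ∈ D.adj s ↔ ∀ i, s + D.b i ≤ ipair (D.A i) x := by
  simp [adj, le_dist_iff, dF, le_sub_iff_add_le]

lemma convex_adj (s : ℝ) : Convex ℝ (D.adj s) := by
  have : D.adj s = {x | ∀ i ∈ Set.univ, s + D.b i ≤ ipair (D.A i) x} := by
    ext x; simp [mem_adj]
  rw [this]
  exact convex_setOf_le_ipair _ _ _

lemma adj_subset_pts {s : ℝ} (hs : 0 ≤ s) : D.adj s ⊆ D.pts := fun x hx i => by
  linarith [D.mem_adj.mp hx i]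

lemma continuous_dist : Continuous D.dist := by
  have : D.dist = Finset.univ.inf'
      (Finset.univ_nonempty_iff.mpr (Fin.pos_iff_nonempty.mp D.hm)) D.dF := by
    ext x; simp [dist, Finset.inf'_apply]
  rw [this]
  exact Continuous.finset_inf' _ fun i _ => (continuous_ipair _).sub continuous_const

/-- The maximum of the distance to the boundary is positive and attained, at height
`μ(P)⁻¹`. -/
lemma qcdInv_isMax : 0 < D.qcdInv ∧ (∀ x, D.dist x ≤ D.qcdInv) ∧ D.core.Nonempty := by
  obtain ⟨x, hx, hmax⟩ := D.isCompact_pts.exists_isMaxOn D.pts_nonempty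
    D.continuous_dist.continuousOn
  obtain ⟨z, hz⟩ := D.interior_pts_nonempty
  have hzpos : 0 < D.dist z := by
    obtain ⟨i, -, hi⟩ := Finset.exists_mem_eq_inf'
      (Finset.univ_nonempty_iff.mpr (Fin.pos_iff_nonempty.mp D.hm)) (fun i => D.dF i z)
    rw [dist, hi, dF, sub_pos]
    exact lt_ipair_of_mem_interior (S := D.pts) (D.prim i).1 (fun y hy => hy i) hz
  have hpos : 0 < D.dist x := hzpos.trans_le (hmax (interior_subset hz))
  have hle : ∀ y, D.dist y ≤ D.dist x := fun y => by
    by_contra! h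
    exact h.not_ge (hmax (D.adj_subset_pts (hpos.trans h).le (le_refl (D.dist y))))
  have hgreat : IsGreatest D.qcdInvSet (D.dist x) :=
    ⟨⟨hpos, x, le_refl (D.dist x)⟩, fun s ⟨_, y, hy⟩ => le_trans hy (hle y)⟩
  have heq : D.qcdInv = D.dist x := hgreat.csSup_eq
  exact ⟨heq ▸ hpos, fun y => heq ▸ hle y, x, heq.le⟩

/-- A primitive inequality defining a face of codimension one is one of the facet
inequalities. -/
lemma exists_facet_eq {c : Fin n → ℤ} (hc : IsPrimitive c) {β : ℝ}
    (hvalid : ∀ x ∈ D.pts, β ≤ ipair c x)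
    (hne : {x ∈ D.pts | ipair c x = β}.Nonempty)
    (hdim : setDim {x ∈ D.pts | ipair c x = β} + 1 = n) :
    ∃ j, D.A j = c ∧ (D.b j : ℝ) = β := by
  set F := {x ∈ D.pts | ipair c x = β} with hF
  have hFconv : Convex ℝ F := by
    have : Convex ℝ {x : Fin n → ℝ | ipair c x = β} :=
      convex_hyperplane (ipairLin c).isLinear β
    exact D.convex_pts.inter this
  obtain ⟨z, hz, hstrict⟩ := hFconv.exists_forall_strict hne Finset.univ
    (fun j => ipairLin (D.A j)) (fun j => (D.b j : ℝ)) (fun j _ x hx => hx.1 j)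
  have hj : ∃ j, ipair (D.A j) z = D.b j := by
    by_contra! hall
    obtain ⟨w, hw⟩ := exists_ipair_eq_one hc.1
    obtain ⟨ε, hε, h⟩ := exists_pos_forall_nonneg_add_mul Finset.univ
      (fun j => ipair (D.A j) z - D.b j) (fun j => -ipair (D.A j) w)
      (fun j _ => Or.inl (sub_pos.mpr (lt_of_le_of_ne (hz.1 j) (hall j).symm)))
    have hmem : z - ε • w ∈ D.pts := fun j => by
      have := h j (Finset.mem_univ j)
      rw [ipair_sub, ipair_smul]
      linarith
    have := hvalid _ hmem
    rw [ipair_sub, ipair_smul, hw, hz.2] at this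
    linarith
  obtain ⟨j, hj⟩ := hj
  have hconst : ∀ y ∈ F, ipair (D.A j) y = D.b j := fun y hy => by
    by_contra hne
    have := hstrict j (Finset.mem_univ j) ⟨y, hy, lt_of_le_of_ne (hy.1 j) (Ne.symm hne)⟩
    rw [ipairLin_apply, hj] at this
    exact lt_irrefl _ this
  have hker : LinearMap.ker (ipairLin c) ≤ LinearMap.ker (ipairLin (D.A j)) := by
    rw [← Submodule.eq_of_le_of_finrank_eq (vectorSpan_le_ker_of_const (fun x hx => hx.2))
      (show Module.finrank ℝ (vectorSpan ℝ F) = _ by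
        have := finrank_ker_ipairLin hc.1
        rw [setDim] at hdim
        omega)]
    exact vectorSpan_le_ker_of_const hconst
  obtain ⟨w, hw⟩ := exists_ipair_eq_one hc.1
  have hprop : ∀ x, ipair (D.A j) x = ipair (D.A j) w * ipair c x := fun x => by
    have hx : x - ipair c x • w ∈ LinearMap.ker (ipairLin c) := by
      simp [ipair_sub, ipair_smul, hw]
    have := hker hx
    simp only [LinearMap.mem_ker, ipairLin_apply, ipair_sub, ipair_smul] at this
    linarith
  have hpos : 0 < ipair (D.A j) w := by
    obtain ⟨x, hx⟩ := D.interior_pts_nonempty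
    have h1 := lt_ipair_of_mem_interior hc.1 hvalid hx
    have h2 := lt_ipair_of_mem_interior (S := D.pts) (D.prim j).1 (fun y hy => hy j) hx
    rw [← hj, hprop x, hprop z, hz.2] at h2
    nlinarith
  have hA := (D.prim j).eq_of_ipair_eq_mul hc hpos hprop
  exact ⟨j, hA, by rw [← hj, hA, hz.2]⟩

/-- Every facet inequality can be sharpened to one that defines a nonempty face of codimension
one. The sharpening is only needed in dimension one, where the dimension condition on facets
also holds for the empty set. -/
lemma exists_face_codim_one (i : Fin m) :
    ∃ β : ℝ, (D.b i : ℝ) ≤ β ∧ (∀ x ∈ D.pts, β ≤ ipair (D.A i) x) ∧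
      {x ∈ D.pts | ipair (D.A i) x = β}.Nonempty ∧
      setDim {x ∈ D.pts | ipair (D.A i) x = β} + 1 = n := by
  rcases (Nat.succ_le_of_lt D.dim_pos).lt_or_eq with hn | hn
  · refine ⟨D.b i, le_rfl, fun x hx => hx i, nonempty_of_setDim_pos ?_, D.facet_dim i⟩
    have : setDim {x ∈ D.pts | ipair (D.A i) x = D.b i} + 1 = n := D.facet_dim i
    omega
  · obtain ⟨x, hx, hmin⟩ := D.isCompact_pts.exists_isMinOn D.pts_nonempty
      (continuous_ipair (D.A i)).continuousOn
    refine ⟨ipair (D.A i) x, hx i, fun y hy => hmin hy, ⟨x, hx, rfl⟩, ?_⟩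
    have h1 := Submodule.finrank_mono (vectorSpan_le_ker_of_const
      (S := {y ∈ D.pts | ipair (D.A i) y = ipair (D.A i) x}) (fun y hy => hy.2))
    have h2 := finrank_ker_ipairLin (D.prim i).1
    rw [setDim]
    omega

/-- A point in the relative interior of the core, described by the inequalities that are tight
at it. -/
lemma exists_core_point : ∃ x ∈ D.core,
    (∀ i, D.dF i x = D.qcdInv →
      vectorSpan ℝ D.core ≤ LinearMap.ker (ipairLin (D.A i))) ∧
    ∀ v, (∀ i, D.dF i x = D.qcdInv → 0 ≤ ipair (D.A i) v) → v ∈ vectorSpan ℝ D.core := by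
  obtain ⟨-, -, hne⟩ := D.qcdInv_isMax
  obtain ⟨x, hx, hstrict⟩ := (D.convex_adj D.qcdInv).exists_forall_strict hne Finset.univ
    (fun i => ipairLin (D.A i)) (fun i => D.qcdInv + D.b i) (fun i _ y hy => D.mem_adj.mp hy i)
  refine ⟨x, hx, fun i hi => vectorSpan_le_ker_of_const (β := D.qcdInv + D.b i) ?_, ?_⟩
  · intro y hy
    by_contra hne
    have := hstrict i (Finset.mem_univ i)
      ⟨y, hy, lt_of_le_of_ne (D.mem_adj.mp hy i) (Ne.symm hne)⟩
    rw [ipairLin_apply, ← hi, dF] at this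
    linarith
  · intro v hv
    obtain ⟨ε, hε, h⟩ := exists_pos_forall_nonneg_add_mul Finset.univ
      (fun i => ipair (D.A i) x - (D.qcdInv + D.b i)) (fun i => ipair (D.A i) v) (fun i _ => by
        rcases (D.mem_adj.mp hx i).lt_or_eq with hlt | heq
        · exact Or.inl (sub_pos.mpr hlt)
        · exact Or.inr ⟨by linarith, hv i (by rw [dF]; linarith)⟩)
    have hmem : x + ε • v ∈ D.core := D.mem_adj.mpr fun i => by
      have := h i (Finset.mem_univ i)
      rw [ipair_add, ipair_smul]
      linarith
    have hspan := vsub_mem_vectorSpan ℝ hmem hx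
    rw [vsub_eq_sub, add_sub_cancel_left] at hspan
    exact (Submodule.smul_mem_iff _ hε.ne').mp hspan

end PolyDesc

/-- A subset of `ℝⁿ` cut out by finitely many linear inequalities with integer coefficients. -/
def IsIntPolyhedron {n : ℕ} (S : Set (Fin n → ℝ)) : Prop :=
  ∃ T : Finset ((Fin n → ℤ) × ℤ), S = {x | ∀ p ∈ T, (p.2 : ℝ) ≤ ipair p.1 x}

lemma Finset.exists_between_of_forall_le {ι : Type*} (L U : Finset ι) (l u : ι → ℝ)
    (h : ∀ p ∈ L, ∀ q ∈ U, l p ≤ u q) :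
    ∃ t, (∀ p ∈ L, l p ≤ t) ∧ ∀ q ∈ U, t ≤ u q := by
  rcases L.eq_empty_or_nonempty with rfl | hL
  · rcases U.eq_empty_or_nonempty with rfl | hU
    · exact ⟨0, by simp, by simp⟩
    · obtain ⟨q, -, hq⟩ := U.exists_min_image u hU
      exact ⟨u q, by simp, hq⟩
  · obtain ⟨p, hp, hmax⟩ := L.exists_max_image l hL
    exact ⟨l p, hmax, h p hp⟩

/-- Fourier–Motzkin elimination of one integral direction. -/
lemma IsIntPolyhedron.add_line {n : ℕ} {S : Set (Fin n → ℝ)} (hS : IsIntPolyhedron S)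
    (v : Fin n → ℤ) :
    IsIntPolyhedron {x | ∃ t : ℝ, x + t • (fun j => (v j : ℝ)) ∈ S} := by
  classical
  obtain ⟨T, rfl⟩ := hS
  set c : (Fin n → ℤ) × ℤ → ℤ := fun p => ∑ j, p.1 j * v j with hc
  have hcv : ∀ p : (Fin n → ℤ) × ℤ, ipair p.1 (fun j => (v j : ℝ)) = c p := fun p => by
    simp [ipair, hc]
  refine ⟨T.filter (fun p => c p = 0) ∪ Finset.image₂
    (fun p q => (c p • q.1 - c q • p.1, c p * q.2 - c q * p.2))
    (T.filter (fun p => 0 < c p)) (T.filter (fun p => c p < 0)), ?_⟩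
  ext x
  simp only [Set.mem_ofPred_eq, ipair_add, ipair_smul, hcv]
  constructor
  · rintro ⟨t, ht⟩ r hr
    rcases Finset.mem_union.mp hr with hr | hr
    · obtain ⟨hrT, hr0⟩ := Finset.mem_filter.mp hr
      simpa [hr0] using ht r hrT
    · obtain ⟨p, hp, q, hq, rfl⟩ := Finset.mem_image₂.mp hr
      obtain ⟨hpT, hp0⟩ := Finset.mem_filter.mp hp
      obtain ⟨hqT, hq0⟩ := Finset.mem_filter.mp hq
      have hp0' : (0 : ℝ) < c p := by exact_mod_cast hp0
      have hq0' : (c q : ℝ) < 0 := by exact_mod_cast hq0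
      have h1 := mul_le_mul_of_nonneg_left (ht q hqT) hp0'.le
      have h2 := mul_le_mul_of_nonneg_left (ht p hpT) (neg_pos.mpr hq0').le
      simp only [ipair_sub_left, ipair_smul_left]
      push_cast
      linarith
  · intro h
    obtain ⟨t, hL, hU⟩ := Finset.exists_between_of_forall_le (T.filter (fun p => 0 < c p))
      (T.filter (fun p => c p < 0)) (fun p => (p.2 - ipair p.1 x) / c p)
      (fun q => (ipair q.1 x - q.2) / (-c q)) (fun p hp q hq => by
        have hp0' : (0 : ℝ) < c p := by exact_mod_cast (Finset.mem_filter.mp hp).2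
        have hq0' : (0 : ℝ) < -c q := by
          rw [neg_pos]
          exact_mod_cast (Finset.mem_filter.mp hq).2
        have := h _ (Finset.mem_union_right _ (Finset.mem_image₂_of_mem hp hq))
        simp only [ipair_sub_left, ipair_smul_left] at this
        push_cast at this
        rw [div_le_div_iff₀ hp0' hq0']
        linarith)
    refine ⟨t, fun p hp => ?_⟩
    rcases lt_trichotomy (c p) 0 with hlt | h0 | hgt
    · have h1 := hU p (Finset.mem_filter.mpr ⟨hp, hlt⟩)
      have h2 : (0 : ℝ) < -c p := by
        rw [neg_pos]
        exact_mod_cast hlt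
      rw [le_div_iff₀ h2] at h1
      linarith
    · have := h p (Finset.mem_union_left _ (Finset.mem_filter.mpr ⟨hp, h0⟩))
      simpa [h0] using this
    · have h1 := hL p (Finset.mem_filter.mpr ⟨hp, hgt⟩)
      have h2 : (0 : ℝ) < c p := by exact_mod_cast hgt
      rw [div_le_iff₀ h2] at h1
      linarith

lemma IsIntPolyhedron.add_span {n : ℕ} {S : Set (Fin n → ℝ)} (hS : IsIntPolyhedron S)
    {ι : Type*} (s : Finset ι) (v : ι → Fin n → ℤ) :
    IsIntPolyhedron {x | ∃ t : ι → ℝ, x + ∑ i ∈ s, t i • (fun j => (v i j : ℝ)) ∈ S} := by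
  classical
  induction s using Finset.induction_on with
  | empty => simpa using hS
  | insert i s his ih =>
    convert ih.add_line (v i) using 1
    ext x
    simp only [Set.mem_ofPred_eq]
    constructor
    · rintro ⟨t, ht⟩
      exact ⟨t i, t, by rwa [Finset.sum_insert his, ← add_assoc] at ht⟩
    · rintro ⟨r, t, ht⟩
      refine ⟨Function.update t i r, ?_⟩
      rw [Finset.sum_insert his, Function.update_self, ← add_assoc,
        Finset.sum_congr rfl fun j hj => by
          rw [Function.update_of_ne (ne_of_mem_of_not_mem hj his)]]
      exact ht

/-- A full-dimensional bounded set given by finitely many integral inequalities has an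
irredundant facet description. -/
lemma IsIntPolyhedron.exists_polyDesc {n : ℕ} {Q : Set (Fin n → ℝ)} (hQ : IsIntPolyhedron Q)
    (hn : 0 < n) (hbdd : Bornology.IsBounded Q) (hdim : setDim Q = n) :
    ∃ m, ∃ D : PolyDesc n m, D.pts = Q := by
  classical
  have hQne : Q.Nonempty := nonempty_of_setDim_pos (by omega)
  set good : Set (Finset ((Fin n → ℤ) × ℚ)) :=
    {T | (∀ p ∈ T, IsPrimitive p.1) ∧ Q = {x | ∀ p ∈ T, (p.2 : ℝ) ≤ ipair p.1 x}} with hgood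
  have hex : good.Nonempty := by
    obtain ⟨T, hT⟩ := hQ
    choose! g a hg ha hga using fun (p : (Fin n → ℤ) × ℤ) (hp : p.1 ≠ 0) =>
      exists_isPrimitive_smul hp
    refine ⟨(T.filter (fun p => p.1 ≠ 0)).image (fun p => (a p, (p.2 : ℚ) / g p)), ?_, ?_⟩
    · intro q hq
      obtain ⟨p, hp, rfl⟩ := Finset.mem_image.mp hq
      exact ha p (Finset.mem_filter.mp hp).2
    · have hiff : ∀ p : (Fin n → ℤ) × ℤ, p.1 ≠ 0 → ∀ x,
          (((p.2 : ℚ) / g p : ℚ) : ℝ) ≤ ipair (a p) x ↔ (p.2 : ℝ) ≤ ipair p.1 x := by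
        intro p hp x
        have h0 : (0 : ℝ) < g p := by exact_mod_cast hg p hp
        conv_rhs => rw [hga p hp, ipair_smul_left]
        push_cast
        rw [div_le_iff₀ h0, mul_comm]
      ext x
      constructor
      · intro hx q hq
        obtain ⟨p, hp, rfl⟩ := Finset.mem_image.mp hq
        obtain ⟨hpT, hp0⟩ := Finset.mem_filter.mp hp
        rw [hT] at hx
        exact (hiff p hp0 x).mpr (hx p hpT)
      · intro hx
        rw [hT]
        intro p hp
        by_cases hp0 : p.1 = 0
        · obtain ⟨y, hy⟩ := hQne
          rw [hT] at hy
          have := hy p hp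
          simpa [hp0, ipair] using this
        · exact (hiff p hp0 x).mp
            (hx _ (Finset.mem_image_of_mem _ (Finset.mem_filter.mpr ⟨hp, hp0⟩)))
  obtain ⟨T, ⟨hprim, hT⟩, hmin⟩ := (measure Finset.card).wf.has_min good hex
  have hconv : Convex ℝ Q := by
    rw [hT]
    exact convex_setOf_le_ipair (T : Set ((Fin n → ℤ) × ℚ)) (fun p => p.1) (fun p => (p.2 : ℝ))
  obtain ⟨z, hz⟩ := hconv.interior_nonempty_of_setDim_eq hQne hdim
  have hzlt : ∀ p ∈ T, (p.2 : ℝ) < ipair p.1 z := fun p hp =>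
    lt_ipair_of_mem_interior (S := Q) (hprim p hp).1
      (fun y hy => by rw [hT] at hy; exact hy p hp) hz
  have hfacet : ∀ p ∈ T,
      setDim {x : Fin n → ℝ | (∀ q ∈ T, (q.2 : ℝ) ≤ ipair q.1 x) ∧ ipair p.1 x = p.2} + 1 = n := by
    intro p hp
    have hnot : T.erase p ∉ good := fun h => hmin _ h (Finset.card_erase_lt_of_mem hp)
    obtain ⟨x, hx, hxp⟩ : ∃ x, (∀ q ∈ T, q ≠ p → (q.2 : ℝ) ≤ ipair q.1 x) ∧
        ipair p.1 x < p.2 := by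
      by_contra! h
      refine hnot ⟨fun q hq => hprim q (Finset.mem_of_mem_erase hq), ?_⟩
      rw [hT]
      ext x
      refine ⟨fun hx q hq => hx q (Finset.mem_of_mem_erase hq), fun hx q hq => ?_⟩
      have hx' : ∀ q ∈ T, q ≠ p → (q.2 : ℝ) ≤ ipair q.1 x := fun q hq hqp =>
        hx q (Finset.mem_erase.mpr ⟨hqp, hq⟩)
      by_cases hqp : q = p
      · rw [hqp]; exact h x hx'
      · exact hx' q hq hqp
    set θ : ℝ := (ipair p.1 z - p.2) / (ipair p.1 z - ipair p.1 x) with hθ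
    have hzp := hzlt p hp
    have hden : 0 < ipair p.1 z - ipair p.1 x := by linarith
    have hθ0 : 0 ≤ θ := div_nonneg (by linarith) hden.le
    have hθ1 : θ < 1 := (div_lt_one hden).mpr (by linarith)
    have hθeq : θ * (ipair p.1 z - ipair p.1 x) = ipair p.1 z - p.2 :=
      div_mul_cancel₀ _ hden.ne'
    set w := z + θ • (x - z) with hw
    have hwp : ipair p.1 w = p.2 := by
      rw [hw, ipair_add, ipair_smul, ipair_sub]
      linarith
    have hwq : ∀ q ∈ T, q ≠ p → (q.2 : ℝ) < ipair q.1 w := by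
      intro q hq hqp
      rw [hw, ipair_add, ipair_smul, ipair_sub]
      nlinarith [hzlt q hq, hx q hq hqp]
    set F := {x : Fin n → ℝ | (∀ q ∈ T, (q.2 : ℝ) ≤ ipair q.1 x) ∧ ipair p.1 x = p.2} with hF
    have hmemF : ∀ y, ipair p.1 y = p.2 → (∀ q ∈ T, q ≠ p → (q.2 : ℝ) ≤ ipair q.1 y) → y ∈ F :=
      fun y h1 h2 => ⟨fun q hq => by
        by_cases hqp : q = p
        · rw [hqp, h1]
        · exact h2 q hq hqp, h1⟩
    have hwF : w ∈ F := hmemF w hwp fun q hq hqp => (hwq q hq hqp).le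
    have hspan : vectorSpan ℝ F = LinearMap.ker (ipairLin p.1) := by
      refine le_antisymm (vectorSpan_le_ker_of_const fun x hx => hx.2) fun u hu => ?_
      have hu0 : ipair p.1 u = 0 := hu
      obtain ⟨ε, hε, h⟩ := exists_pos_forall_nonneg_add_mul (T.erase p)
        (fun q => ipair q.1 w - q.2) (fun q => ipair q.1 u) (fun q hq => Or.inl (sub_pos.mpr
          (hwq q (Finset.mem_of_mem_erase hq) (Finset.ne_of_mem_erase hq))))
      have hmem : w + ε • u ∈ F := by
        refine hmemF _ ?_ fun q hq hqp => ?_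
        · rw [ipair_add, ipair_smul, hu0, hwp, mul_zero, add_zero]
        · have := h q (Finset.mem_erase.mpr ⟨hqp, hq⟩)
          rw [ipair_add, ipair_smul]
          linarith
      have hsp := vsub_mem_vectorSpan ℝ hmem hwF
      rw [vsub_eq_sub, add_sub_cancel_left] at hsp
      exact (Submodule.smul_mem_iff _ hε.ne').mp hsp
    rw [setDim, hspan]
    exact finrank_ker_ipairLin (hprim p hp).1
  have hTne : T.Nonempty := by
    rw [Finset.nonempty_iff_ne_empty]
    rintro rfl
    have : Nonempty (Fin n) := ⟨⟨0, hn⟩⟩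
    have huniv : Q = Set.univ := by simpa using hT
    rw [huniv] at hbdd
    exact NormedSpace.unbounded_univ ℝ (Fin n → ℝ) hbdd
  let e := T.equivFin.symm
  have hall : ∀ x : Fin n → ℝ, (∀ i, ((e i).1.2 : ℝ) ≤ ipair (e i).1.1 x) ↔
      ∀ p ∈ T, (p.2 : ℝ) ≤ ipair p.1 x := fun x => by
    rw [e.forall_congr_left]
    simp [Subtype.forall]
  have hQ' : {x : Fin n → ℝ | ∀ i, ((e i).1.2 : ℝ) ≤ ipair (e i).1.1 x} = Q := by
    rw [hT]
    ext x
    exact hall x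
  refine ⟨T.card, ⟨hTne.card_pos, fun i => (e i).1.1, fun i => (e i).1.2,
    fun i => hprim _ (e i).2, by rwa [hQ'], by rwa [hQ'], fun i => ?_, ?_⟩, hQ'⟩
  · simp only [hall]
    exact hfacet _ (e i).2
  · intro i j hij
    exact e.injective (Subtype.ext hij)

lemma setDim_image {n n' : ℕ} (π : (Fin n → ℝ) →ₗ[ℝ] (Fin n' → ℝ)) (S : Set (Fin n → ℝ)) :
    setDim (π '' S) = Module.finrank ℝ ((vectorSpan ℝ S).map π) := by
  have := π.toAffineMap.map_vectorSpan (s := S)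
  rw [LinearMap.toAffineMap_linear] at this
  rw [this, setDim]
  rfl

/-- A linear map sending `ℤⁿ` onto `ℤ^{n'}` has an integral section. Integral functionals pull
back to integral functionals along both maps, and the kernel is spanned by integral vectors. -/
lemma exists_integral_section {n n' : ℕ} (π : (Fin n → ℝ) →ₗ[ℝ] (Fin n' → ℝ))
    (hlat : π '' IntPts n = IntPts n') :
    ∃ σ : (Fin n' → ℝ) →ₗ[ℝ] (Fin n → ℝ), (∀ y, π (σ y) = y) ∧
      (∀ a : Fin n → ℤ, ∃ c : Fin n' → ℤ, ∀ y, ipair a (σ y) = ipair c y) ∧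
      (∀ c : Fin n' → ℤ, ∃ a : Fin n → ℤ, ∀ x, ipair c (π x) = ipair a x) ∧
      ∃ v : Fin n → Fin n → ℤ, ∀ x,
        x - σ (π x) = ∑ j, x j • (fun k => (v j k : ℝ)) := by
  have hsingle : ∀ {k : ℕ} (j : Fin k), (Pi.single j 1 : Fin k → ℝ) ∈ IntPts k := fun j =>
    ⟨Pi.single j 1, by ext i; by_cases h : i = j <;> simp [h]⟩
  have hw : ∀ j : Fin n', ∃ w : Fin n → ℤ,
      π (fun k => (w k : ℝ)) = Pi.single j 1 := fun j => by
    have := hsingle j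
    rw [← hlat] at this
    obtain ⟨_, ⟨w, rfl⟩, h⟩ := this
    exact ⟨w, h⟩
  choose w hw using hw
  have hM : ∀ j : Fin n, ∃ M : Fin n' → ℤ, (fun k => (M k : ℝ)) = π (Pi.single j 1) := fun j => by
    have : π (Pi.single j 1) ∈ IntPts n' := hlat ▸ Set.mem_image_of_mem π (hsingle j)
    exact this
  choose M hM using hM
  have hπ : ∀ x, π x = ∑ j, x j • (fun k => (M j k : ℝ)) := fun x => by
    conv_lhs => rw [pi_eq_sum_univ' x]
    simp [hM, map_sum]
  let σ : (Fin n' → ℝ) →ₗ[ℝ] (Fin n → ℝ) := Fintype.linearCombination ℝ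
    (fun j => (fun k => (w j k : ℝ) : Fin n → ℝ))
  have hσ : ∀ y, σ y = ∑ j, y j • (fun k => (w j k : ℝ)) := fun y =>
    Fintype.linearCombination_apply ℝ _ _
  refine ⟨σ, fun y => ?_, fun a => ⟨fun j => ∑ k, a k * w j k, fun y => ?_⟩,
    fun c => ⟨fun j => ∑ k, c k * M j k, fun x => ?_⟩,
    fun j k => (Pi.single j 1 : Fin n → ℤ) k - ∑ l, M j l * w l k, fun x => ?_⟩
  · rw [hσ, map_sum]
    conv_rhs => rw [pi_eq_sum_univ' y]
    simp [hw]
  · rw [hσ, ← ipairLin_apply, map_sum]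
    simp only [map_smul, ipairLin_apply, smul_eq_mul]
    simp only [ipair]
    push_cast
    exact Finset.sum_congr rfl fun j _ => mul_comm _ _
  · rw [hπ, ← ipairLin_apply, map_sum]
    simp only [map_smul, ipairLin_apply, smul_eq_mul]
    simp only [ipair]
    push_cast
    exact Finset.sum_congr rfl fun j _ => mul_comm _ _
  · ext k
    rw [hσ, hπ]
    simp only [Pi.sub_apply, Finset.sum_apply, Pi.smul_apply, smul_eq_mul]
    push_cast
    simp only [mul_sub, Finset.sum_sub_distrib, Finset.mul_sum, Finset.sum_mul]
    congr 1
    · simp [Pi.single_apply]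
    · rw [Finset.sum_comm]
      exact Finset.sum_congr rfl fun j _ => Finset.sum_congr rfl fun l _ => mul_assoc _ _ _

lemma IsIntPolyhedron.image_of_lattice {n n' : ℕ} {S : Set (Fin n → ℝ)} (hS : IsIntPolyhedron S)
    (π : (Fin n → ℝ) →ₗ[ℝ] (Fin n' → ℝ)) (hlat : π '' IntPts n = IntPts n') :
    IsIntPolyhedron (π '' S) := by
  classical
  obtain ⟨σ, hπσ, hpull, -, v, hv⟩ := exists_integral_section π hlat
  obtain ⟨T, hT⟩ := hS.add_span Finset.univ v
  choose c hc using hpull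
  have hker : ∀ t : Fin n → ℝ, π (∑ j, t j • (fun k => (v j k : ℝ))) = 0 := fun t => by
    rw [← hv, map_sub, hπσ, sub_self]
  have himage : π '' S = {y | σ y ∈
      {x | ∃ t : Fin n → ℝ, x + ∑ j, t j • (fun k => (v j k : ℝ)) ∈ S}} := by
    ext y
    constructor
    · rintro ⟨x, hx, rfl⟩
      exact ⟨x, by rwa [← hv, add_sub_cancel]⟩
    · rintro ⟨t, ht⟩
      exact ⟨_, ht, by rw [map_add, hπσ, hker, add_zero]⟩
  refine ⟨T.image fun p => (c p.1, p.2), ?_⟩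
  rw [himage, hT]
  ext y
  simp only [Set.mem_ofPred_eq, Finset.forall_mem_image, hc]

lemma PolyDesc.isIntPolyhedron_pts {n m : ℕ} (D : PolyDesc n m) : IsIntPolyhedron D.pts := by
  classical
  refine ⟨Finset.univ.image fun i => ((D.b i).den • D.A i, (D.b i).num), ?_⟩
  ext x
  simp only [PolyDesc.pts, Set.mem_ofPred_eq, Finset.mem_image, Finset.mem_univ, true_and,
    forall_exists_index, forall_apply_eq_imp_iff]
  refine forall_congr' fun i => ?_
  have hden : (0 : ℝ) < (D.b i).den := by exact_mod_cast (D.b i).den_pos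
  have hb : ((D.b i).num : ℝ) = (D.b i).den * (D.b i : ℝ) := by
    have := Rat.den_mul_eq_num (D.b i)
    exact_mod_cast this.symm
  rw [← natCast_zsmul, ipair_smul_left, hb]
  push_cast
  rw [mul_le_mul_iff_right₀ hden]

/-- Let `π : ℝⁿ → ℝⁿ/K(P)` be the natural projection; we realize the
quotient as a surjective linear map `π : ℝⁿ → ℝ^{n'}` with kernel `K(P)` mapping `ℤⁿ`
onto `ℤ^{n'}` (so that `ℤ^{n'}` realizes the lattice `L = ℤⁿ/(K(P) ∩ ℤⁿ)`). Then
`Q = π(P)` is a full-dimensional rational polytope with respect to `L`, i.e. it admits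
an irredundant facet description `D'`, and for any such description
`μ(Q) ≥ μ(P)`; moreover, if `μ(Q) = μ(P)` then `core(Q)` is the single point
`π(core(P))`. -/
theorem statement8 {n m n' : ℕ} (D : PolyDesc n m)
    (π : (Fin n → ℝ) →ₗ[ℝ] (Fin n' → ℝ))
    (hsurj : Function.Surjective π)
    (hker : LinearMap.ker π = vectorSpan ℝ D.core)
    (hlat : π '' IntPts n = IntPts n') :
    (∃ m' : ℕ, ∃ D' : PolyDesc n' m', D'.pts = π '' D.pts) ∧
    (∀ {m' : ℕ} (D' : PolyDesc n' m'), D'.pts = π '' D.pts →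
      D.qcd ≤ D'.qcd ∧
      (D'.qcd = D.qcd → ∃ y : Fin n' → ℝ, π '' D.core = {y} ∧ D'.core = {y})) := by
  obtain ⟨σ, hπσ, hpull, hlift, -⟩ := exists_integral_section π hlat
  obtain ⟨x₀, hx₀, htight, hcone⟩ := D.exists_core_point
  obtain ⟨hspos, hsmax, -⟩ := D.qcdInv_isMax
  obtain ⟨i₀, hi₀⟩ : ∃ i, D.dF i x₀ = D.qcdInv := by
    obtain ⟨i, -, hi⟩ := Finset.exists_mem_eq_inf'
      (Finset.univ_nonempty_iff.mpr (Fin.pos_iff_nonempty.mp D.hm)) (fun i => D.dF i x₀)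
    exact ⟨i, hi ▸ le_antisymm (hsmax x₀) hx₀⟩
  have hfactor : ∀ i, D.dF i x₀ = D.qcdInv → ∃ c : Fin n' → ℤ, IsPrimitive c ∧
      ∀ x, ipair c (π x) = ipair (D.A i) x := by
    intro i hi
    obtain ⟨c, hc⟩ := hpull (D.A i)
    have hcπ : ∀ x, ipair c (π x) = ipair (D.A i) x := fun x => by
      have hmem : x - σ (π x) ∈ LinearMap.ker π := by simp [hπσ]
      rw [hker] at hmem
      have := htight i hi hmem
      rw [LinearMap.mem_ker, ipairLin_apply, ipair_sub] at this
      rw [← hc]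
      linarith
    refine ⟨c, ⟨?_, fun k b hb => ?_⟩, hcπ⟩
    · rintro rfl
      obtain ⟨w, hw⟩ := exists_ipair_eq_one (D.prim i).1
      have := hcπ w
      rw [hw] at this
      simp [ipair] at this
    · obtain ⟨a, ha⟩ := hlift b
      refine (D.prim i).2 k a ?_
      ext j
      have h1 := hcπ (Pi.single j 1)
      rw [hb, ipair_smul_left, ha, ipair_single, ipair_single] at h1
      simpa using (by exact_mod_cast h1.symm : D.A i j = k * a j)
  have hn' : 0 < n' := (hfactor i₀ hi₀).choose_spec.1.pos
  refine ⟨?_, fun {m'} D' hD' => ?_⟩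
  · refine (D.isIntPolyhedron_pts.image_of_lattice π hlat).exists_polyDesc hn' ?_ ?_
    · exact (D.isCompact_pts.image π.continuous_of_finiteDimensional).isBounded
    · have htop : vectorSpan ℝ D.pts = ⊤ :=
        Submodule.eq_top_of_finrank_eq (D.fulldim.trans (by simp))
      rw [setDim_image, htop, Submodule.map_top, LinearMap.range_eq_top.mpr hsurj]
      simp
  · have hbound : ∀ i, D.dF i x₀ = D.qcdInv → ∀ x, D'.dist (π x) ≤ D.dF i x := by
      intro i hi x
      obtain ⟨c, hc, hcπ⟩ := hfactor i hi
      obtain ⟨β, hβ, hvalid, hne, hdim⟩ := D.exists_face_codim_one i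
      have hface : {y ∈ D'.pts | ipair c y = β} = π '' {x ∈ D.pts | ipair (D.A i) x = β} := by
        ext y
        constructor
        · rintro ⟨hy, hyβ⟩
          rw [hD'] at hy
          obtain ⟨x, hx, rfl⟩ := hy
          exact ⟨x, ⟨hx, by rw [← hcπ, hyβ]⟩, rfl⟩
        · rintro ⟨x, ⟨hx, hxβ⟩, rfl⟩
          exact ⟨hD' ▸ Set.mem_image_of_mem π hx, by rw [hcπ, hxβ]⟩
      have hspan : vectorSpan ℝ {x ∈ D.pts | ipair (D.A i) x = β} =
          LinearMap.ker (ipairLin (D.A i)) := by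
        refine Submodule.eq_of_le_of_finrank_eq
          (vectorSpan_le_ker_of_const fun x hx => hx.2) ?_
        have := finrank_ker_ipairLin (D.prim i).1
        rw [setDim] at hdim
        omega
      have hkereq : LinearMap.ker (ipairLin (D.A i)) =
          (LinearMap.ker (ipairLin c)).comap π := by
        ext x
        simp [hcπ]
      obtain ⟨j, hAj, hbj⟩ := D'.exists_facet_eq hc (β := β)
        (fun y hy => by
          rw [hD'] at hy
          obtain ⟨x, hx, rfl⟩ := hy
          rw [hcπ]
          exact hvalid x hx)
        (by rw [hface]; exact hne.image π)
        (by
          rw [hface, setDim_image, hspan, hkereq, Submodule.map_comap_eq_of_surjective hsurj]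
          exact finrank_ker_ipairLin hc.1)
      have := D'.le_dist_iff.mp (le_refl (D'.dist (π x))) j
      rw [PolyDesc.dF, hAj, hbj, hcπ] at this
      rw [PolyDesc.dF]
      linarith
    obtain ⟨hspos', -, y, hy⟩ := D'.qcdInv_isMax
    have hcore : ∀ y, D.qcdInv ≤ D'.dist y → y = π x₀ := by
      intro y hy
      obtain ⟨x, rfl⟩ := hsurj y
      have hmem : x - x₀ ∈ LinearMap.ker π := by
        rw [hker]
        refine hcone _ fun i hi => ?_
        have h1 := hy.trans (hbound i hi x)
        rw [← hi, PolyDesc.dF, PolyDesc.dF] at h1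
        rw [ipair_sub]
        linarith
      rw [LinearMap.mem_ker, map_sub, sub_eq_zero] at hmem
      exact hmem
    have hle : D'.qcdInv ≤ D.qcdInv := by
      by_contra! h
      have hyx := hcore y (h.le.trans hy)
      have h1 : D'.qcdInv ≤ D'.dist y := hy
      have h2 := hbound i₀ hi₀ x₀
      rw [hi₀, ← hyx] at h2
      linarith
    refine ⟨inv_anti₀ hspos' hle, fun heq => ⟨π x₀, ?_, ?_⟩⟩
    · refine Set.eq_singleton_iff_unique_mem.mpr ⟨Set.mem_image_of_mem π hx₀, ?_⟩
      rintro _ ⟨x, hx, rfl⟩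
      have := vsub_mem_vectorSpan ℝ hx hx₀
      rw [← hker, LinearMap.mem_ker, vsub_eq_sub, map_sub, sub_eq_zero] at this
      exact this
    · have heq' : D'.qcdInv = D.qcdInv := inv_injective heq
      have hall : ∀ z ∈ D'.core, z = π x₀ := fun z hz => hcore z (heq' ▸ hz)
      exact Set.eq_singleton_iff_unique_mem.mpr ⟨hall y hy ▸ hy, hall⟩

end
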